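/- arXiv:1702.03806 — 2 statements merged into one kernel-verified Lean document; each statement's English description precedes it below -/
import Mathlib

section
/- Let k be a field and A a commutative Noetherian local k-algebra with maximal ideal m such that the residue field A/m is isomorphic to k. If f ∈ A satisfies φ(f) = 0 for every n ≥ 1 and every k-algebra homomorphism φ : A → M_n(k), then f = 0. -/
/-- A quotient `A ⧸ I` is a finite `k`-module if and only if some finitely generated
`k`-submodule of `A` is a supplement to `I`. -/
theorem Ideal.finite_quotient_iff_exists_fg_sup_eq_top
    {k A : Type*} [CommRing k] [CommRing A] [Algebra k A] (I : Ideal A) :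
    Module.Finite k (A ⧸ I) ↔
      ∃ V : Submodule k A, V.FG ∧ V ⊔ I.restrictScalars k = ⊤ := by
  have hker : LinearMap.ker (Ideal.Quotient.mkₐ k I).toLinearMap = I.restrictScalars k := by
    ext x
    simp [Ideal.Quotient.eq_zero_iff_mem]
  have hsurj : Function.Surjective (Ideal.Quotient.mkₐ k I).toLinearMap :=
    Ideal.Quotient.mkₐ_surjective k I
  constructor
  · rintro ⟨t, ht⟩
    classical
    refine ⟨Submodule.span k (t.image (Function.surjInv hsurj)), ⟨_, rfl⟩, ?_⟩
    rw [← hker, ← Submodule.comap_map_eq, Submodule.map_span, Finset.coe_image, ← Set.image_comp]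
    have hid : (Ideal.Quotient.mkₐ k I).toLinearMap ∘ Function.surjInv hsurj = id :=
      funext (Function.surjInv_eq hsurj)
    rw [hid, Set.image_id, ht, Submodule.comap_top]
  · rintro ⟨V, hV, hsup⟩
    refine ⟨?_⟩
    have hmap : V.map (Ideal.Quotient.mkₐ k I).toLinearMap = ⊤ := by
      rw [← hker, ← Submodule.comap_map_eq] at hsup
      rw [← Submodule.map_comap_eq_of_surjective hsurj (V.map _), hsup, Submodule.map_top]
      exact LinearMap.range_eq_top.2 hsurj
    exact hmap ▸ hV.map _

/-- If `I` is a finitely generated ideal such that `A ⧸ I` is a finite `k`-module, then so is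
`A ⧸ I ^ n`. -/
theorem Ideal.moduleFinite_quotient_pow
    {k A : Type*} [CommRing k] [CommRing A] [Algebra k A] {I : Ideal A} (hI : I.FG)
    [Module.Finite k (A ⧸ I)] (n : ℕ) : Module.Finite k (A ⧸ I ^ n) := by
  obtain ⟨V, hV, hVI⟩ := I.finite_quotient_iff_exists_fg_sup_eq_top.1 ‹Module.Finite k (A ⧸ I)›
  rw [Ideal.finite_quotient_iff_exists_fg_sup_eq_top]
  induction n with
  | zero =>
    refine ⟨⊥, Submodule.fg_bot, ?_⟩
    simp [Ideal.one_eq_top]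
  | succ n ih =>
    obtain ⟨W, hW, hWI⟩ := ih
    obtain ⟨s, hs⟩ := hI.pow (n := n)
    refine ⟨W ⊔ V * Submodule.span k s, hW.sup (hV.mul ⟨s, rfl⟩), ?_⟩
    have hle : (I ^ n).restrictScalars k ≤
        V * Submodule.span k s ⊔ (I ^ (n + 1)).restrictScalars k := by
      intro x hx
      rw [Submodule.restrictScalars_mem, ← hs] at hx
      induction hx using Submodule.closure_induction with
      | zero => exact zero_mem _
      | add x y _ _ hx hy => exact add_mem hx hy
      | smul_mem a x hx =>
        obtain ⟨v, hv, i, hi, rfl⟩ :=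
          Submodule.mem_sup.1 (hVI.symm ▸ Submodule.mem_top : a ∈ V ⊔ I.restrictScalars k)
        rw [smul_eq_mul, add_mul]
        refine Submodule.add_mem_sup (Submodule.mul_mem_mul hv (Submodule.subset_span hx)) ?_
        rw [Submodule.restrictScalars_mem, pow_succ']
        exact Ideal.mul_mem_mul hi (hs ▸ Submodule.subset_span hx)
    rw [eq_top_iff, ← hWI, sup_assoc]
    exact sup_le_sup_left hle W

/-- An element killed by all matrix representations lies in every ideal of finite codimension. -/
theorem Ideal.mem_of_forall_matrix_rep_eq_zero
    {k A : Type*} [Field k] [CommRing A] [Algebra k A] (I : Ideal A) [Module.Finite k (A ⧸ I)]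
    {f : A} (h : ∀ (n : ℕ), 0 < n → ∀ φ : A →ₐ[k] Matrix (Fin n) (Fin n) k, φ f = 0) :
    f ∈ I := by
  rcases (Module.finrank k (A ⧸ I)).eq_zero_or_pos with hn | hn
  · have := Module.finrank_zero_iff.1 hn
    exact Ideal.Quotient.eq_zero_iff_mem.1 (Subsingleton.elim _ _)
  · let b := Module.finBasis k (A ⧸ I)
    have hf := h _ hn ((Algebra.leftMulMatrix b).comp (Ideal.Quotient.mkₐ k I))
    refine Ideal.Quotient.eq_zero_iff_mem.1 (Algebra.leftMulMatrix_injective b ?_)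
    simpa using hf

/-- Let `k` be a field and `A` a commutative Noetherian local `k`-algebra whose residue field
is isomorphic to `k`. If `f ∈ A` is killed by every `k`-algebra homomorphism
`A → Mₙ(k)` (for every `n ≥ 1`), then `f = 0`. -/
theorem eq_zero_of_forall_matrix_rep_eq_zero
    (k : Type*) [Field k] (A : Type*) [CommRing A] [IsNoetherianRing A] [IsLocalRing A]
    [Algebra k A] (res : IsLocalRing.ResidueField A ≃ₐ[k] k)
    (f : A)
    (h : ∀ (n : ℕ), 0 < n → ∀ φ : A →ₐ[k] Matrix (Fin n) (Fin n) k, φ f = 0) :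
    f = 0 := by
  have : Module.Finite k (A ⧸ IsLocalRing.maximalIdeal A) :=
    Module.Finite.equiv (M := k) (N := IsLocalRing.ResidueField A) res.symm.toLinearEquiv
  rw [← Ideal.mem_bot, ← Ideal.iInf_pow_eq_bot_of_isLocalRing (IsLocalRing.maximalIdeal A)
    Ideal.IsPrime.ne_top', Ideal.mem_iInf]
  intro n
  have := Ideal.moduleFinite_quotient_pow (k := k)
    (IsNoetherian.noetherian (IsLocalRing.maximalIdeal A)) n
  exact Ideal.mem_of_forall_matrix_rep_eq_zero _ h
end

section
/- (Cartan's uniqueness theorem) Let G ⊆ C^n be a bounded connected open set, let p ∈ G, and let f : G → G be a holomorphic map with f(p) = p and Df(p) = id. Then f(z) = z for all z ∈ G. -/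
open Set Filter Topology Metric Asymptotics

section

variable {E F : Type*} [NormedAddCommGroup E] [NormedSpace ℂ E]
  [NormedAddCommGroup F] [NormedSpace ℂ F]

/-- A complex differentiable function near `p` whose derivative at `p` vanishes is strictly
differentiable at `p`. -/
theorem hasStrictFDerivAt_zero_of_differentiableOn {g : E → F} {U : Set E} {p : E}
    (hg : DifferentiableOn ℂ g U) (hU : U ∈ 𝓝 p) (hp : HasFDerivAt g (0 : E →L[ℂ] F) p) :
    HasStrictFDerivAt g (0 : E →L[ℂ] F) p := by
  obtain ⟨r, hr, hrU, hrb⟩ : ∃ r > 0, ball p r ⊆ U ∧ MapsTo g (ball p r) (closedBall (g p) 1) := by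
    have h1 := hp.continuousAt.preimage_mem_nhds (closedBall_mem_nhds (g p) one_pos)
    obtain ⟨r, hr, h⟩ := Metric.mem_nhds_iff.1 (inter_mem hU h1)
    exact ⟨r, hr, fun x hx => (h hx).1, fun x hx => (h hx).2⟩
  have hd : DifferentiableOn ℂ g (ball p r) := hg.mono hrU
  have ho : (g · - g p) =o[𝓝 p] (fun w ↦ ‖w - p‖ ^ 1) := by
    simpa using hp.isLittleO.norm_right
  have hquad : ∀ z ∈ ball p r, dist (g z) (g p) ≤ 1 * (dist z p / r) ^ 2 := fun z hz =>
    Complex.dist_le_mul_div_pow_of_mapsTo_ball_of_isLittleO hd hrb ho hz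
  have hbound : ∀ ρ, 0 < ρ → 2 * ρ ≤ r → ∀ z ∈ ball p ρ, ‖fderiv ℂ g z‖ ≤ 8 / r ^ 2 * ρ := by
    intro ρ hρ hρr z hz
    have hsub : ball z ρ ⊆ ball p (2 * ρ) := ball_subset_ball' (by
      rw [mem_ball] at hz; linarith)
    have hsmall : ∀ w ∈ ball p (2 * ρ), dist (g w) (g p) ≤ 4 * ρ ^ 2 / r ^ 2 := by
      intro w hw
      refine (hquad w (ball_subset_ball hρr hw)).trans ?_
      have h2 : dist w p / r ≤ 2 * ρ / r := by
        gcongr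
        exact (mem_ball.1 hw).le
      calc 1 * (dist w p / r) ^ 2 ≤ 1 * (2 * ρ / r) ^ 2 := by gcongr
        _ = _ := by ring
    have hz' : z ∈ ball p (2 * ρ) := hsub (mem_ball_self hρ)
    have := Complex.norm_fderiv_le_div_of_mapsTo_ball (R₂ := 8 * ρ ^ 2 / r ^ 2)
      (hd.mono (hsub.trans (ball_subset_ball hρr)))
      (fun w hw => by
        have h1 := hsmall w (hsub hw)
        have h2 := hsmall z hz'
        have h3 := dist_triangle_right (g w) (g z) (g p)
        have h4 : 8 * ρ ^ 2 / r ^ 2 = 4 * ρ ^ 2 / r ^ 2 + 4 * ρ ^ 2 / r ^ 2 := by ring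
        rw [mem_closedBall]
        linarith) hρ
    refine this.trans_eq ?_
    field_simp
  have hev : ∀ᶠ z in 𝓝 p, HasFDerivAt g (fderiv ℂ g z) z := by
    filter_upwards [ball_mem_nhds p hr] with z hz
    exact (hd.differentiableAt (isOpen_ball.mem_nhds hz)).hasFDerivAt
  have hcont : ContinuousAt (fderiv ℂ g) p := by
    rw [Metric.continuousAt_iff]
    intro ε hε
    obtain ⟨ρ, hρ, hρr, hρε⟩ : ∃ ρ > 0, 2 * ρ ≤ r ∧ 8 / r ^ 2 * ρ < ε := by
      refine ⟨min (r / 2) (ε * r ^ 2 / 16), by positivity, ?_, ?_⟩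
      · linarith [min_le_left (r / 2) (ε * r ^ 2 / 16)]
      · calc 8 / r ^ 2 * min (r / 2) (ε * r ^ 2 / 16) ≤ 8 / r ^ 2 * (ε * r ^ 2 / 16) := by
              gcongr
              exact min_le_right _ _
          _ = ε / 2 := by field_simp; norm_num
          _ < ε := half_lt_self hε
    refine ⟨ρ, hρ, fun {z} hz => ?_⟩
    rw [hp.fderiv, dist_zero_right]
    exact (hbound ρ hρ hρr z hz).trans_lt hρε
  simpa [hp.fderiv] using hasStrictFDerivAt_of_hasFDerivAt_of_continuousAt hev hcont

/-- The identity principle on a ball, for functions on a complex normed space. -/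
theorem DifferentiableOn.eqOn_zero_ball_of_eventuallyEq_zero [CompleteSpace F] {h : E → F}
    {c w : E} {r : ℝ} (hd : DifferentiableOn ℂ h (ball c r)) (hw : w ∈ ball c r)
    (hw0 : h =ᶠ[𝓝 w] 0) : EqOn h 0 (ball c r) := by
  intro z hz
  let l : ℂ → E := fun t => w + t • (z - w)
  have hl : Differentiable ℂ l := by fun_prop
  have hl0 : l 0 = w := by simp [l]
  have hl1 : l 1 = z := by simp [l]
  have hopen : IsOpen (l ⁻¹' ball c r) := isOpen_ball.preimage hl.continuous
  have hconv : Convex ℝ (l ⁻¹' ball c r) := by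
    intro s hs t ht a b ha hb hab
    have : l (a • s + b • t) = a • l s + b • l t := by
      have hw' : w = a • w + b • w := by rw [← add_smul, hab, one_smul]
      simp only [l, smul_add, add_smul, smul_assoc]
      nth_rewrite 1 [hw']
      abel
    rw [mem_preimage, this]
    exact convex_ball c r hs ht ha hb hab
  have han : AnalyticOnNhd ℂ (h ∘ l) (l ⁻¹' ball c r) :=
    (hd.comp hl.differentiableOn (mapsTo_preimage _ _)).analyticOnNhd hopen
  have hev : h ∘ l =ᶠ[𝓝 0] 0 := by
    have : Tendsto l (𝓝 0) (𝓝 w) := by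
      simpa [hl0] using hl.continuous.tendsto 0
    exact this.eventually hw0
  have := han.eqOn_zero_of_preconnected_of_eventuallyEq_zero hconv.isPreconnected
    (show l 0 ∈ ball c r by rwa [hl0]) hev (show l 1 ∈ ball c r by rwa [hl1])
  simpa [hl1] using this

/-- The identity principle for complex differentiable functions on a connected open subset of a
complex normed space. -/
theorem DifferentiableOn.eqOn_zero_of_isPreconnected_of_eventuallyEq_zero [CompleteSpace F]
    {h : E → F} {U : Set E} {p : E} (hd : DifferentiableOn ℂ h U) (hU : IsOpen U)
    (hconn : IsPreconnected U) (hp : p ∈ U) (hp0 : h =ᶠ[𝓝 p] 0) : EqOn h 0 U := by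
  have hsub : U ⊆ {x | h =ᶠ[𝓝 x] 0} := by
    refine hconn.subset_of_closure_inter_subset isOpen_setOfPred_eventually_nhds ⟨p, hp, hp0⟩ ?_
    rintro x ⟨hxcl, hxU⟩
    obtain ⟨r, hr, hrU⟩ := Metric.isOpen_iff.1 hU x hxU
    obtain ⟨w, hw0, hw⟩ := Metric.mem_closure_iff.1 hxcl r hr
    filter_upwards [ball_mem_nhds x hr] using
      (hd.mono hrU).eqOn_zero_ball_of_eventuallyEq_zero (mem_ball'.2 hw) hw0
  exact fun x hx => (hsub hx).self_of_nhds

/-- If the iterates of `f` are uniformly close to the identity near the fixed point `p`, where `f`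
is tangent to the identity, then the order of contact of `f` with the identity is infinite. -/
theorem isLittleO_sub_id_pow_of_iterate_bounded {f : E → E} {p : E} {r M : ℝ} (hr : 0 < r)
    (hd : ∀ k, DifferentiableOn ℂ f^[k] (ball p r)) (hfp : f p = p)
    (hM : ∀ k, ∀ z ∈ ball p r, ‖f^[k] z - z‖ ≤ M)
    (hf : HasFDerivAt f (ContinuousLinearMap.id ℂ E) p) (m : ℕ) :
    (fun z => f z - z) =o[𝓝 p] (fun z => ‖z - p‖ ^ (m + 1)) := by
  have hfix : ∀ k, f^[k] p = p := fun k => Function.iterate_fixed hfp k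
  have hg : HasFDerivAt (fun z => f z - z) (0 : E →L[ℂ] E) p := by
    simpa using! hf.sub (hasFDerivAt_id p)
  have hgs := hasStrictFDerivAt_zero_of_differentiableOn
    ((hd 1).sub differentiableOn_id) (ball_mem_nhds p hr) hg
  have hcont : ∀ k, Tendsto f^[k] (𝓝 p) (𝓝 p) := fun k => by
    have := ((hd k).continuousOn.continuousAt (ball_mem_nhds p hr)).tendsto
    rwa [hfix k] at this
  induction m with
  | zero => simpa [hfp] using hg.isLittleO.norm_right
  | succ m ih =>
    have hpos : ∀ z, 0 ≤ ‖z - p‖ ^ (m + 1 + 1) := fun z => by positivity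
    -- Schwarz's lemma upgrades `o(‖z - p‖ ^ (m + 1))` for the iterates to an explicit bound.
    have hschwarz : ∀ k, (fun z => f^[k] z - z) =o[𝓝 p] (fun z => ‖z - p‖ ^ (m + 1)) →
        ∀ z ∈ ball p r, ‖f^[k] z - z‖ ≤ M / r ^ (m + 1 + 1) * ‖z - p‖ ^ (m + 1 + 1) := by
      intro k hk z hz
      have := Complex.dist_le_mul_div_pow_of_mapsTo_ball_of_isLittleO
        (f := fun z => f^[k] z - z) (c := p) (R₁ := r) (R₂ := M) (n := m + 1)
        ((hd k).sub differentiableOn_id)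
        (fun z hz => by simpa [hfix k] using hM k z hz) (by simpa [hfix k] using hk) hz
      simp only [hfix k, sub_self, dist_zero_right, dist_eq_norm z p] at this
      refine this.trans_eq ?_
      rw [div_pow]
      ring
    have hle : (fun z => ‖z - p‖ ^ (m + 1 + 1)) =O[𝓝 p] (fun z => ‖z - p‖ ^ (m + 1)) := by
      have h1 : (fun z => ‖z - p‖) =O[𝓝 p] (fun _ => (1 : ℝ)) :=
        (Continuous.tendsto (by fun_prop) p).isBigO_one ℝ
      simpa [pow_succ] using (isBigO_refl (fun z => ‖z - p‖ ^ (m + 1)) (𝓝 p)).mul h1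
    have hlow : ∀ k : ℕ, (fun z => f^[k] z - z - (k : ℂ) • (f z - z)) =o[𝓝 p]
        (fun z => ‖z - p‖ ^ (m + 1 + 1)) →
        (fun z => f^[k] z - z) =o[𝓝 p] (fun z => ‖z - p‖ ^ (m + 1)) := fun k hk => by
      simpa using (hk.trans_isBigO hle).add (ih.const_smul_left (k : ℂ))
    have hexp : ∀ k : ℕ, (fun z => f^[k] z - z - (k : ℂ) • (f z - z)) =o[𝓝 p]
        (fun z => ‖z - p‖ ^ (m + 1 + 1)) := by
      intro k
      induction k with
      | zero => simp
      | succ k ihk =>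
        have hkO : (fun z => f^[k] z - z) =O[𝓝 p] (fun z => ‖z - p‖ ^ (m + 1 + 1)) := by
          refine IsBigO.of_bound (M / r ^ (m + 1 + 1)) ?_
          filter_upwards [ball_mem_nhds p hr] with z hz
          rw [Real.norm_of_nonneg (hpos z)]
          exact hschwarz k (hlow k ihk) z hz
        have hlip :=
          (hgs.isLittleO.comp_tendsto ((hcont k).prodMk_nhds tendsto_id)).trans_isBigO hkO
        refine (hlip.add ihk).congr_left fun z => ?_
        simp [Function.iterate_succ_apply', add_smul]
        abel
    refine IsLittleO.of_bound fun ε hε => ?_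
    set C := M / r ^ (m + 1 + 1)
    obtain ⟨k, hk⟩ := exists_nat_gt (max 1 (C / (ε / 2)))
    have hk1 : (1 : ℝ) ≤ k := (le_max_left _ _).trans hk.le
    have hkC : C ≤ k * (ε / 2) := by
      rw [← div_le_iff₀ (half_pos hε)]
      exact (le_max_right _ _).trans hk.le
    filter_upwards [(hexp k).bound (half_pos hε), ball_mem_nhds p hr] with z hz hzr
    rw [Real.norm_of_nonneg (hpos z)] at hz ⊢
    have h1 := hschwarz k (hlow k (hexp k)) z hzr
    have h2 : (k : ℝ) * ‖f z - z‖ ≤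
        ‖f^[k] z - z‖ + ‖f^[k] z - z - (k : ℂ) • (f z - z)‖ := by
      have := norm_sub_le (f^[k] z - z) (f^[k] z - z - (k : ℂ) • (f z - z))
      rwa [sub_sub_cancel, norm_smul, Complex.norm_natCast] at this
    have h3 : C * ‖z - p‖ ^ (m + 1 + 1) ≤ k * (ε / 2) * ‖z - p‖ ^ (m + 1 + 1) :=
      mul_le_mul_of_nonneg_right hkC (hpos z)
    have h4 : ε / 2 * ‖z - p‖ ^ (m + 1 + 1) ≤ k * (ε / 2 * ‖z - p‖ ^ (m + 1 + 1)) :=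
      le_mul_of_one_le_left (mul_nonneg (half_pos hε).le (hpos z)) hk1
    refine le_of_mul_le_mul_left ?_ (zero_lt_one.trans_le hk1)
    linarith

end

/-- **Cartan's uniqueness theorem.** Let `G ⊆ ℂⁿ` be a bounded connected open set, `p ∈ G`,
and `f : G → G` holomorphic with `f(p) = p` and `Df(p) = id`. Then `f(z) = z` on `G`. -/
theorem cartan_uniqueness (n : ℕ) (G : Set (EuclideanSpace ℂ (Fin n)))
    (hGopen : IsOpen G) (hGconn : IsConnected G) (hGbdd : Bornology.IsBounded G)
    (f : EuclideanSpace ℂ (Fin n) → EuclideanSpace ℂ (Fin n))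
    (hf : DifferentiableOn ℂ f G) (hmaps : Set.MapsTo f G G)
    (p : EuclideanSpace ℂ (Fin n)) (hp : p ∈ G) (hfp : f p = p)
    (hDf : fderiv ℂ f p = ContinuousLinearMap.id ℂ (EuclideanSpace ℂ (Fin n))) :
    ∀ z ∈ G, f z = z := by
  obtain ⟨r, hr, hrG⟩ := Metric.isOpen_iff.1 hGopen p hp
  obtain ⟨M, hM⟩ := Metric.isBounded_iff.1 hGbdd
  have hbound : ∀ k, ∀ z ∈ ball p r, ‖f^[k] z - z‖ ≤ M := fun k z hz => by
    simpa [dist_eq_norm] using hM (hmaps.iterate k (hrG hz)) (hrG hz)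
  have hiter : ∀ k, DifferentiableOn ℂ f^[k] G := fun k => hf.iterate hmaps k
  have hfd : HasFDerivAt f (ContinuousLinearMap.id ℂ _) p := by
    rw [← hDf]
    exact (hf.differentiableAt (hGopen.mem_nhds hp)).hasFDerivAt
  have hd : DifferentiableOn ℂ (fun z => f z - z) G := hf.sub differentiableOn_id
  have hlocal : (fun z => f z - z) =ᶠ[𝓝 p] 0 := by
    filter_upwards [ball_mem_nhds p hr] with z hz
    have hle : ∀ m : ℕ, ‖f z - z‖ ≤ M * (dist z p / r) ^ (m + 2) := fun m => by
      have := Complex.dist_le_mul_div_pow_of_mapsTo_ball_of_isLittleO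
        (f := fun z => f z - z) (c := p) (R₁ := r) (R₂ := M) (n := m + 1) (hd.mono hrG)
        (fun z hz => by simpa [hfp] using hbound 1 z hz)
        (by simpa [hfp] using isLittleO_sub_id_pow_of_iterate_bounded hr
              (fun k => (hiter k).mono hrG) hfp hbound hfd m) hz
      simpa [hfp] using this
    have hlim : Tendsto (fun m : ℕ => M * (dist z p / r) ^ (m + 2)) atTop (𝓝 0) := by
      have := (tendsto_pow_atTop_nhds_zero_of_lt_one (r := dist z p / r) (by positivity)
        ((div_lt_one hr).2 hz))
      simpa using ((tendsto_add_atTop_iff_nat 2).2 this).const_mul M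
    exact norm_le_zero_iff.1 (ge_of_tendsto' hlim hle)
  intro z hz
  exact sub_eq_zero.1 (hd.eqOn_zero_of_isPreconnected_of_eventuallyEq_zero hGopen
    hGconn.isPreconnected hp hlocal hz)
end
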